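/- Let σ > -1, λ = d+1+σ, and n a positive integer. With the Bloch seminorm ‖f‖_𝓑 = sup_{z∈B} (1-|z|²) (Σ_{j=1}^d |∂f/∂z_j(z)|^p)^{1/p} (the case n = 1), the Bergman projection satisfies ‖T_σ‖_{L^∞(B) → 𝓑} = C_p · Γ(λ+1) / Γ((λ+1)/2)², where C_p = d^{1/p - 1/2} if 1 ≤ p < 2 and C_p = 1 if 2 ≤ p < ∞. -/

import Mathlib

open MeasureTheory Complex Metric
open scoped ENNReal Classical

noncomputable section

abbrev Cd (d : ℕ) : Type := EuclideanSpace ℂ (Fin d)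

instance (d : ℕ) : MeasurableSpace (Cd d) := borel _
instance (d : ℕ) : BorelSpace (Cd d) := ⟨rfl⟩
noncomputable instance (d : ℕ) : MeasureSpace (Cd d) := measureSpaceOfInnerProductSpace

/-- The open unit ball of `ℂ^d`. -/
def unitBall (d : ℕ) : Set (Cd d) := Metric.ball 0 1

/-- Lebesgue measure on `ℂ^d`, normalized so that the unit ball has measure one. -/
def normVol (d : ℕ) : Measure (Cd d) := (volume (unitBall d))⁻¹ • volume

/-- The inner product `⟨z,w⟩ = ∑ z_j conj (w_j)`. -/
def herm {d : ℕ} (z w : Cd d) : ℂ := ∑ j, z j * (starRingEnd ℂ) (w j)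

/-- The normalizing constant `c_σ`. -/
def cCoef (d : ℕ) (σ : ℝ) : ℝ :=
  Real.Gamma (d + σ + 1) / (Real.Gamma (σ + 1) * Real.Gamma (d + 1))

/-- The Bergman kernel `K_σ(z,w) = (1-|w|²)^σ / (1-⟨z,w⟩)^{d+1+σ}`. -/
def bergKer (d : ℕ) (σ : ℝ) (z w : Cd d) : ℂ :=
  (((1 - ‖w‖ ^ 2 : ℝ) ^ σ : ℝ) : ℂ) / (1 - herm z w) ^ ((((d : ℝ) + 1 + σ : ℝ)) : ℂ)

/-- The Bergman projection `T_σ f (z) = c_σ ∫_B K_σ(z,w) f(w) dv(w)`. -/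
def bergman (d : ℕ) (σ : ℝ) (f : Cd d → ℂ) (z : Cd d) : ℂ :=
  (cCoef d σ : ℂ) * ∫ w in unitBall d, bergKer d σ z w * f w ∂(normVol d)

/-- The complex partial derivative `∂/∂z_j`. -/
def pd (d : ℕ) (j : Fin d) (f : Cd d → ℂ) : Cd d → ℂ :=
  fun z => fderiv ℂ f z (EuclideanSpace.single j 1)

/-- The complex partial derivative `∂^α` for a multi-index `α`. -/
def mpd (d : ℕ) (α : Fin d → ℕ) (f : Cd d → ℂ) : Cd d → ℂ :=
  (List.finRange d).foldr (fun j g => (pd d j)^[α j] g) f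

/-- Multi-indices `α ∈ ℤ₊^d` with `|α| = n`; there are `d̃ = (n+d-1).choose (d-1)` of them. -/
def MIdx (d n : ℕ) : Type := {α : Fin d → ℕ // ∑ j, α j = n}

instance (d n : ℕ) : Fintype (MIdx d n) :=
  Fintype.subtype (Finset.Nat.antidiagonalTuple d n)
    (fun _ => Finset.Nat.mem_antidiagonalTuple)

/-- `𝒟_z f (z) = (∂^α f(z))_{|α|=n} ∈ ℂ^{d̃}`. -/
def Dmap (d n : ℕ) (f : Cd d → ℂ) (z : Cd d) : MIdx d n → ℂ := fun α => mpd d α.1 f z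

/-- `Z(ζ) = (ζ^α)_{|α|=n} ∈ ℂ^{d̃}`. -/
def Zmap (d n : ℕ) (ζ : Cd d) : MIdx d n → ℂ := fun α => ∏ j, ζ j ^ α.1 j

/-- The Bloch seminorm `‖f‖_𝓑 = sup_{z∈B} (1-|z|²)^n |𝒟_z f(z)|` w.r.t. a norm `N` on `ℂ^{d̃}`. -/
def blochSemi (d n : ℕ) (N : (MIdx d n → ℂ) → ℝ) (f : Cd d → ℂ) : ℝ :=
  ⨆ z : unitBall d, (1 - ‖(z : Cd d)‖ ^ 2) ^ n * N (Dmap d n f z)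

/-- The seminorm of `T_σ : L^∞(B) → 𝓑`, i.e. `sup_{‖G‖_∞ ≤ 1} ‖T_σ G‖_𝓑`. -/
def opSemi (d n : ℕ) (σ : ℝ) (N : (MIdx d n → ℂ) → ℝ) : ℝ :=
  ⨆ G : {G : Cd d → ℂ // Measurable G ∧ ∀ w, ‖G w‖ ≤ 1},
    blochSemi d n N (bergman d σ G.1)

/-- `𝓒 = max_{|ζ|=1} |Z(ζ)|`. -/
def maxC (d n : ℕ) (N : (MIdx d n → ℂ) → ℝ) : ℝ :=
  ⨆ ζ : Metric.sphere (0 : Cd d) 1, N (Zmap d n (ζ : Cd d))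

/-- The Möbius automorphism `φ_z` of the unit ball, with `φ_0 = -id`. -/
def moebius (d : ℕ) (z ω : Cd d) : Cd d :=
  if z = 0 then -ω
  else (1 - herm ω z)⁻¹ •
    (z - (herm ω z / ((‖z‖ ^ 2 : ℝ) : ℂ)) • z
       - ((Real.sqrt (1 - ‖z‖ ^ 2) : ℝ) : ℂ) • (ω - (herm ω z / ((‖z‖ ^ 2 : ℝ) : ℂ)) • z))

end

section PartA
open Filter Topology

/-- ratio sequence -/
noncomputable def qs (l : ℝ) (n : ℕ) : ℝ :=
  Real.Gamma ((l+1)/2 + n) ^ 2 / ((n.factorial : ℝ) * Real.Gamma (l + n))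

lemma qs_pos {l : ℝ} (hl : 0 < l) (n : ℕ) : 0 < qs l n := by
  have h1 : 0 < Real.Gamma ((l+1)/2 + n) := Real.Gamma_pos_of_pos (by positivity)
  have h2 : 0 < Real.Gamma (l + n) := Real.Gamma_pos_of_pos (by positivity)
  unfold qs; positivity

lemma qs_mono {l : ℝ} (hl : 0 < l) : Monotone (qs l) := by
  apply monotone_nat_of_le_succ
  intro n
  have h1 : 0 < Real.Gamma ((l+1)/2 + n) := Real.Gamma_pos_of_pos (by positivity)
  have h2 : 0 < Real.Gamma (l + n) := Real.Gamma_pos_of_pos (by positivity)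
  unfold qs
  have e1 : Real.Gamma ((l+1)/2 + (n+1:ℕ)) = ((l+1)/2 + n) * Real.Gamma ((l+1)/2 + n) := by
    rw [← Real.Gamma_add_one (by positivity)]; push_cast; ring_nf
  have e2 : Real.Gamma (l + (n+1:ℕ)) = (l + n) * Real.Gamma (l + n) := by
    rw [← Real.Gamma_add_one (by positivity)]; push_cast; ring_nf
  rw [e1, e2, Nat.factorial_succ]
  push_cast
  rw [div_le_div_iff₀ (by positivity) (by positivity)]
  have : 0 ≤ Real.Gamma ((l+1)/2 + n)^2 * (n.factorial * Real.Gamma (l+n)) := by positivity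
  have h3 : ((n:ℝ)+1) * (l+n) ≤ ((l+1)/2+n)^2 := by nlinarith [sq_nonneg (l-1)]
  nlinarith [mul_le_mul_of_nonneg_left h3 this]

lemma prod_eq_Gamma {s : ℝ} (hs : 0 < s) (n : ℕ) :
    ∏ j ∈ Finset.range n, (s + j) = Real.Gamma (s + n) / Real.Gamma s := by
  have hg := Real.Gamma_pos_of_pos hs
  induction n with
  | zero => simp [hg.ne']
  | succ n ih =>
    rw [Finset.prod_range_succ, ih]
    push_cast
    rw [← add_assoc, Real.Gamma_add_one (by positivity)]
    ring

lemma gamma_ratio_tendsto {s : ℝ} (hs : 0 < s) :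
    Tendsto (fun n : ℕ => Real.Gamma (s + (n+1:ℕ)) / ((n:ℝ)^s * n.factorial)) atTop (𝓝 1) := by
  have hg := Real.Gamma_pos_of_pos hs
  have h := (Real.GammaSeq_tendsto_Gamma s).inv₀ hg.ne'
  have h2 := h.const_mul (Real.Gamma s)
  rw [mul_inv_cancel₀ hg.ne'] at h2
  refine h2.congr fun n => ?_
  rw [Real.GammaSeq, prod_eq_Gamma hs, inv_div]
  field_simp

lemma qs_tendsto {l : ℝ} (hl : 0 < l) : Tendsto (qs l) atTop (𝓝 1) := by
  rw [← tendsto_add_atTop_iff_nat 1]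
  have h1 := (gamma_ratio_tendsto (s := (l+1)/2) (by positivity)).pow 2
  have h2 := gamma_ratio_tendsto hl
  have h3 := (h1.div h2 one_ne_zero).mul (tendsto_natCast_div_add_atTop (1:ℝ))
  norm_num at h3
  refine h3.congr' ?_
  filter_upwards [eventually_gt_atTop 0] with n hn
  have hn' : (0:ℝ) < n := by exact_mod_cast hn
  have g2 : 0 < Real.Gamma (l + (n+1:ℕ)) := Real.Gamma_pos_of_pos (by positivity)
  have e : ((n:ℝ)^((l+1)/2))^2 = (n:ℝ)^l * n := by
    rw [← Real.rpow_natCast, ← Real.rpow_mul hn'.le, ← Real.rpow_add_one hn'.ne']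
    congr 1; push_cast; ring
  have hp : 0 < (n:ℝ)^l := by positivity
  push_cast at g2
  unfold qs
  rw [Nat.factorial_succ]
  push_cast
  rw [div_pow, mul_pow, e]
  field_simp

lemma qs_le_one {l : ℝ} (hl : 0 < l) (n : ℕ) : qs l n ≤ 1 :=
  (qs_mono hl).ge_of_tendsto (qs_tendsto hl) n

lemma qs_summable {l : ℝ} (hl : 0 < l) {x : ℝ} (hx : 0 ≤ x) (hx1 : x < 1) :
    Summable (fun n => qs l n * x^n) := by
  refine Summable.of_nonneg_of_le (fun n => by have := qs_pos hl n; positivity) (fun n => ?_)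
    (summable_geometric_of_lt_one hx hx1)
  exact mul_le_of_le_one_left (by positivity) (qs_le_one hl n)

lemma qs_upper {l : ℝ} (hl : 0 < l) {x : ℝ} (hx : 0 ≤ x) (hx1 : x < 1) :
    (1 - x) * ∑' n, qs l n * x^n ≤ 1 := by
  have h : ∑' n, qs l n * x^n ≤ ∑' n, x^n :=
    (qs_summable hl hx hx1).tsum_le_tsum
      (fun n => mul_le_of_le_one_left (by positivity) (qs_le_one hl n))
      (summable_geometric_of_lt_one hx hx1)
  rw [tsum_geometric_of_lt_one hx hx1] at h
  have h1 : 0 < 1 - x := by linarith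
  calc _ ≤ (1-x) * (1-x)⁻¹ := by gcongr
    _ = 1 := mul_inv_cancel₀ h1.ne'

lemma qs_lower {l : ℝ} (hl : 0 < l) {x : ℝ} (hx : 0 ≤ x) (hx1 : x < 1) (N : ℕ) :
    qs l N * x^N ≤ (1 - x) * ∑' n, qs l n * x^n := by
  have hs := qs_summable hl hx hx1
  have h1 : 0 < 1 - x := by linarith
  have h2 : ∑' n, qs l (n+N) * x^(n+N) ≤ ∑' n, qs l n * x^n := by
    rw [← hs.sum_add_tsum_nat_add N]
    have : 0 ≤ ∑ i ∈ Finset.range N, qs l i * x^i :=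
      Finset.sum_nonneg fun n _ => by have := qs_pos hl n; positivity
    linarith
  have h3 : ∑' n, qs l N * x^N * x^n ≤ ∑' n, qs l (n+N) * x^(n+N) := by
    refine Summable.tsum_le_tsum (fun n => ?_) ((summable_geometric_of_lt_one hx hx1).mul_left _)
      ((summable_nat_add_iff N).2 hs)
    rw [pow_add, mul_assoc, mul_comm (x^N)]
    gcongr
    exact qs_mono hl (Nat.le_add_left N n)
  rw [tsum_mul_left, tsum_geometric_of_lt_one hx hx1] at h3
  calc qs l N * x^N = (1-x) * (qs l N * x^N * (1-x)⁻¹) := by field_simp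
    _ ≤ _ := by gcongr; linarith

lemma qs_tsum_tendsto {l : ℝ} (hl : 0 < l) {c : ℝ} (hc : c < 1) :
    ∀ᶠ x in 𝓝[<] (1:ℝ), c < (1 - x) * ∑' n, qs l n * x^n := by
  obtain ⟨N, hN⟩ := ((qs_tendsto hl).eventually (lt_mem_nhds hc)).exists
  have : Tendsto (fun x : ℝ => qs l N * x^N) (𝓝[<] 1) (𝓝 (qs l N)) := by
    have : Continuous (fun x : ℝ => qs l N * x^N) := by fun_prop
    have := (this.tendsto 1).mono_left (nhdsWithin_le_nhds (s := Set.Iio 1))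
    simpa using this
  filter_upwards [this.eventually (lt_mem_nhds hN), self_mem_nhdsWithin,
    mem_nhdsWithin_of_mem_nhds (Ioi_mem_nhds (zero_lt_one))] with x hx h1 h0
  exact hx.trans_le (qs_lower hl (le_of_lt h0) h1 N)
end PartA

section PartB
/-- binomial series -/
lemma binom_hasSum {β : ℝ} (hβ : 0 < β) {u : ℂ} (hu : ‖u‖ < 1) :
    HasSum (fun n : ℕ => ((Real.Gamma (β+n) / (Real.Gamma β * n.factorial) : ℝ) : ℂ) * u^n)
      (1 / (1-u)^(β:ℂ)) := by
  have h := (one_div_one_sub_cpow_hasFPowerSeriesOnBall_zero (β:ℂ)).hasSum (y := u)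
    (by
      rw [Metric.mem_eball, edist_zero_right, ← ofReal_norm, ← ENNReal.ofReal_one]
      exact (ENNReal.ofReal_lt_ofReal_iff one_pos).2 hu)
  simp only [zero_add] at h
  convert! h using 2 with n
  rw [FormalMultilinearSeries.ofScalars_apply_eq]
  have e : Ring.choose ((β:ℂ) + n - 1) n = ((Real.Gamma (β+n) / (Real.Gamma β * n.factorial) : ℝ) : ℂ) := by
    have : ((Ring.choose (β + n - 1) n : ℝ) : ℂ) = Ring.choose ((β:ℂ) + n - 1) n := by
      rw [Complex.ofReal_choose]
      congr 1
      push_cast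
      rfl
    rw [← this]
    congr 1
    have h2 : (n.factorial : ℝ) * Ring.choose (β + n - 1) n = Real.Gamma (β+n) / Real.Gamma β := by
      rw [← prod_eq_Gamma hβ, ← nsmul_eq_mul, ← Ring.multichoose_eq,
        Ring.factorial_nsmul_multichoose_eq_ascPochhammer, Polynomial.ascPochhammer_smeval_eq_eval]
      clear this h
      induction n with
      | zero => simp
      | succ n ih => rw [ascPochhammer_succ_eval, ih, Finset.prod_range_succ]
    have hf : (n.factorial : ℝ) ≠ 0 := by positivity
    have hg := (Real.Gamma_pos_of_pos hβ).ne'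
    field_simp
    field_simp at h2
    linarith
  rw [e, smul_eq_mul]
end PartB

section PartC
open Set Module
lemma polar_homog {E : Type*} [NormedAddCommGroup E] [NormedSpace ℝ E] [MeasurableSpace E]
    [BorelSpace E] [FiniteDimensional ℝ E] [Nontrivial E] (μ : Measure E) [μ.IsAddHaarMeasure]
    (F : E → ℝ) (k : ℕ) (hF : ∀ r : ℝ, 0 < r → ∀ x, F (r • x) = r^k * F x) (h : ℝ → ℝ) :
    ∫ x, F x * h ‖x‖ ∂μ = (∫ s : sphere (0:E) 1, F s ∂μ.toSphere) *
      ∫ r in Ioi (0:ℝ), r^(finrank ℝ E - 1) * (r^k * h r) := by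
  calc
    ∫ x, F x * h ‖x‖ ∂μ = ∫ x : ({(0)}ᶜ : Set E), F x.1 * h ‖x.1‖ ∂(μ.comap (↑)) := by
      rw [integral_subtype_comap (measurableSet_singleton _).compl fun x ↦ F x * h ‖x‖,
        restrict_compl_singleton]
    _ = ∫ x : sphere (0 : E) 1 × Ioi (0 : ℝ), F x.1.1 * (x.2.1^k * h x.2.1)
        ∂(μ.toSphere.prod (.volumeIoiPow (finrank ℝ E - 1))) := by
      rw [← μ.measurePreserving_homeomorphUnitSphereProd.integral_comp
        (Homeomorph.measurableEmbedding _)]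
      congr 1
      ext x
      have hx : 0 < ‖x.1‖ := norm_pos_iff.2 x.2
      have e : x.1 = ‖x.1‖ • (‖x.1‖⁻¹ • x.1) := by rw [smul_smul, mul_inv_cancel₀ hx.ne', one_smul]
      have := hF _ hx (‖x.1‖⁻¹ • x.1)
      rw [← e] at this
      rw [this]
      simp
      ring
    _ = (∫ s : sphere (0:E) 1, F s ∂μ.toSphere) *
        ∫ x : Ioi (0 : ℝ), x.1^k * h x.1 ∂(.volumeIoiPow (finrank ℝ E - 1)) :=
      integral_prod_mul (fun s : sphere (0:E) 1 => F s.1) (fun x : Ioi (0 : ℝ) => x.1^k * h x.1)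
    _ = _ := by
      congr 1
      rw [Measure.volumeIoiPow, integral_withDensity_eq_integral_toReal_smul,
        ← integral_subtype_comap measurableSet_Ioi (fun r : ℝ => r^(finrank ℝ E - 1) * (r^k * h r))]
      · refine integral_congr_ae (ae_of_all _ fun x => ?_)
        have hx : (0:ℝ) < x.1 := x.2
        simp [ENNReal.toReal_ofReal (pow_nonneg hx.le _)]
      · fun_prop
      · exact ae_of_all _ fun x => ENNReal.ofReal_lt_top

lemma gauss_radial (m : ℕ) : ∫ r in Ioi (0:ℝ), r^(2*m+1) * Real.exp (-r^2) = (m.factorial:ℝ) / 2 := by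
  have := _root_.integral_rpow_mul_exp_neg_rpow (p := 2) (q := (2*m+1:ℕ)) (by norm_num)
    (by have : (0:ℝ) ≤ (2*m+1:ℕ) := by positivity
        linarith)
  rw [show (((2*m+1:ℕ):ℝ)+1)/2 = m + 1 by push_cast; ring, Real.Gamma_nat_eq_factorial] at this
  rw [div_eq_inv_mul, ← one_div, ← this]
  refine setIntegral_congr_fun measurableSet_Ioi fun r hr => ?_
  simp only [Real.rpow_natCast, Real.rpow_ofNat]

lemma beta_radial (m : ℕ) {σ : ℝ} (hσ : -1 < σ) :
    ∫ r in Ioi (0:ℝ), r^(2*m+1) * (if r < 1 then (1 - r^2)^σ else 0) =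
      (m.factorial:ℝ) * Real.Gamma (σ+1) / Real.Gamma (m + σ + 2) / 2 := by
  have hb := Complex.betaIntegral_eq_Gamma_mul_div (m+1) (σ+1) (by simp; positivity) (by simp; linarith)
  have e1 : ((m:ℂ)+1 + (σ+1)) = ((m+σ+2 : ℝ) : ℂ) := by push_cast; ring
  rw [e1, Complex.Gamma_ofReal, show ((m:ℂ)+1) = ((m+1:ℝ):ℂ) by push_cast; rfl,
    show ((σ:ℂ)+1) = ((σ+1:ℝ):ℂ) by push_cast; rfl, Complex.Gamma_ofReal, Complex.Gamma_ofReal,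
    Real.Gamma_nat_eq_factorial, Complex.betaIntegral] at hb
  have h1 : ∫ x in Ioc (0:ℝ) 1, x^m * (1-x)^σ = (m.factorial:ℝ) * Real.Gamma (σ+1) / Real.Gamma (m + σ + 2) := by
    rw [← Complex.ofReal_inj]
    push_cast at hb ⊢
    rw [← hb, intervalIntegral.integral_of_le zero_le_one, ← integral_complex_ofReal]
    refine setIntegral_congr_fun measurableSet_Ioc fun x hx => ?_
    simp only [add_sub_cancel_right, Complex.cpow_natCast]
    push_cast
    rw [Complex.ofReal_cpow (by linarith [hx.2])]
    push_cast
    rfl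
  rw [← h1]
  have h2 := integral_comp_rpow_Ioi_of_pos (g := fun y : ℝ => (Iio (1:ℝ)).indicator (fun y => y^m * (1-y)^σ) y) (p := 2) (by norm_num)
  rw [integral_Ioc_eq_integral_Ioo]
  have h3 : ∫ y in Ioi (0:ℝ), (Iio (1:ℝ)).indicator (fun y => y^m * (1-y)^σ) y = ∫ x in Ioo (0:ℝ) 1, x^m * (1-x)^σ := by
    rw [setIntegral_indicator measurableSet_Iio]; rfl
  rw [← h3, ← h2, ← integral_div]
  refine setIntegral_congr_fun measurableSet_Ioi fun r hr => ?_
  have hr' : (0:ℝ) < r := hr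
  have hiff : r^2 < 1 ↔ r < 1 := by rw [sq_lt_one_iff₀ hr'.le]
  simp only [smul_eq_mul, Real.rpow_ofNat, indicator, mem_Iio, hiff]
  split_ifs
  · rw [show (2:ℝ)-1 = 1 by norm_num, Real.rpow_one]; ring
  · simp

lemma ball_vs_gauss {E : Type*} [NormedAddCommGroup E] [NormedSpace ℝ E] [MeasurableSpace E]
    [BorelSpace E] [FiniteDimensional ℝ E] (μ : Measure E) [μ.IsAddHaarMeasure]
    {d : ℕ} (hd : 0 < d) (hE : finrank ℝ E = 2 * d)
    (F : E → ℝ) (n : ℕ) (hF : ∀ r : ℝ, 0 < r → ∀ x, F (r • x) = r^(2*n) * F x)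
    {σ : ℝ} (hσ : -1 < σ) :
    ∫ x in ball (0:E) 1, F x * (1 - ‖x‖^2)^σ ∂μ =
      (∫ x, F x * Real.exp (-‖x‖^2) ∂μ) * (Real.Gamma (σ+1) / Real.Gamma (d + n + σ + 1)) := by
  have : Nontrivial E := nontrivial_of_finrank_pos (R := ℝ) (by omega)
  obtain ⟨d, rfl⟩ : ∃ d', d = d' + 1 := ⟨d-1, by omega⟩
  rw [polar_homog μ F (2*n) hF (fun r => Real.exp (-r^2)), ← integral_indicator measurableSet_ball]
  have e : (ball (0:E) 1).indicator (fun x => F x * (1 - ‖x‖^2)^σ) =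
      fun x => F x * (fun r : ℝ => if r < 1 then (1-r^2)^σ else 0) ‖x‖ := by
    ext x
    by_cases hx : ‖x‖ < 1 <;> simp [indicator, hx]
  rw [e]
  refine (polar_homog μ F (2*n) hF (fun r : ℝ => if r < 1 then (1-r^2)^σ else 0)).trans ?_
  rw [mul_assoc]
  congr 1
  have hk : finrank ℝ E - 1 = 2 * d + 1 := by omega
  simp only [hk, ← mul_assoc, ← pow_add]
  rw [show 2 * d + 1 + 2 * n = 2 * (d+n) + 1 by ring, gauss_radial, beta_radial _ hσ]
  push_cast
  rw [show ((d:ℝ) + n + σ + 2) = d + 1 + n + σ + 1 by ring]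
  ring
end PartC

section PartD
open Set Module

lemma herm_eq_inner {d : ℕ} (z w : Cd d) : herm z w = inner ℂ w z := by
  simp [herm, PiLp.inner_apply]

lemma unitary_mp {d : ℕ} (U : Cd d ≃ₗᵢ[ℂ] Cd d) :
    MeasurePreserving U (volume : Measure (Cd d)) volume := by
  let V : Cd d ≃ₗᵢ[ℝ] Cd d := ⟨U.toLinearEquiv.restrictScalars ℝ, U.norm_map⟩
  exact V.measurePreserving

lemma exists_unitary {d : ℕ} (i : Fin d) (z : Cd d) (hz : ‖z‖ = 1) :
    ∃ U : Cd d ≃ₗᵢ[ℂ] Cd d, U z = EuclideanSpace.single i 1 := by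
  obtain ⟨b, hb⟩ := Orthonormal.exists_orthonormalBasis_extension_of_card_eq (𝕜 := ℂ) (E := Cd d)
    (ι := Fin d) (by simp) (v := fun _ => z) (s := {i}) (by
      rw [orthonormal_iff_ite]
      intro a b
      have : a = b := Subsingleton.elim _ _
      simp [this, inner_self_eq_norm_sq_to_K, hz])
  refine ⟨b.repr, ?_⟩
  rw [← hb i rfl]
  simp

lemma gauss_coord (d : ℕ) : ∃ K : ℝ, 0 < K ∧ ∀ (n : ℕ) (i : Fin d),
    ∫ w : Cd d, ‖w i‖^(2*n) * Real.exp (-‖w‖^2) = n.factorial * K := by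
  let L := (PiLp.continuousLinearEquiv 2 ℂ (fun _ : Fin d => ℂ)).symm
  let μ' : Measure (Cd d) := Measure.map L (volume : Measure (Fin d → ℂ))
  have hμ' : μ'.IsAddHaarMeasure := L.isAddHaarMeasure_map _
  set c := (volume : Measure (Cd d)).addHaarScalarFactor μ' with hc
  have hvol : (volume : Measure (Cd d)) = c • μ' := Measure.isAddLeftInvariant_eq_smul _ _
  have hcpos : 0 < c := Measure.addHaarScalarFactor_pos_of_isAddHaarMeasure _ _
  refine ⟨c * Real.pi^d, by positivity, fun n i => ?_⟩
  have hC : ∀ m : ℕ, ∫ x : ℂ, ‖x‖^(2*m) * Real.exp (-‖x‖^2) = Real.pi * m.factorial := by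
    intro m
    have := Complex.integral_rpow_mul_exp_neg_rpow (p := 2) (q := (2*m:ℕ)) (by norm_num)
      (by have : (0:ℝ) ≤ (2*m:ℕ) := by positivity
          linarith)
    rw [show (((2*m:ℕ):ℝ)+2)/2 = m + 1 by push_cast; ring, Real.Gamma_nat_eq_factorial] at this
    simp only [Real.rpow_natCast, Real.rpow_ofNat] at this
    rw [this]; ring
  have h0 : ∫ x : Cd d, ‖x i‖^(2*n) * Real.exp (-‖x‖^2) ∂μ' =
      ∫ x : Fin d → ℂ, ‖(L x) i‖^(2*n) * Real.exp (-‖L x‖^2) :=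
    (L.toHomeomorph.measurableEmbedding).integral_map
      (fun x : Cd d => ‖x i‖^(2*n) * Real.exp (-‖x‖^2))
  rw [hvol, integral_smul_nnreal_measure, h0]
  have h1 : ∀ x : Fin d → ℂ, ‖(L x) i‖^(2*n) * Real.exp (-‖L x‖^2) =
      ∏ j, (fun j (y:ℂ) => ‖y‖^(2 * (if j = i then n else 0)) * Real.exp (-‖y‖^2)) j (x j) := by
    intro x
    rw [Finset.prod_mul_distrib, ← Real.exp_sum, EuclideanSpace.norm_sq_eq]
    congr 1
    · rw [Finset.prod_eq_single i]
      · simp [L]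
      · intro j _ hj; simp [hj]
      · simp
    · simp [L]
  have h2 : ∫ x : Fin d → ℂ, ‖(L x) i‖^(2*n) * Real.exp (-‖L x‖^2) = Real.pi^d * n.factorial := by
    rw [integral_congr_ae (ae_of_all _ h1)]
    refine (integral_fintype_prod_volume_eq_prod (fun (j : Fin d) (y:ℂ) =>
      ‖y‖^(2 * (if j = i then n else 0)) * Real.exp (-‖y‖^2))).trans ?_
    simp_rw [hC]
    rw [Finset.prod_mul_distrib, Finset.prod_eq_single (s := Finset.univ) (f := fun x => (((if x = i then n else 0).factorial : ℕ) : ℝ)) i]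
    · simp
    · intro j _ hj; simp [hj]
    · simp
  refine (congrArg (c • ·) h2).trans ?_
  simp [NNReal.smul_def]
  ring

lemma gauss_moment {d : ℕ} (hd : 0 < d) : ∃ K : ℝ, 0 < K ∧ ∀ (n : ℕ) (z : Cd d),
    ∫ w : Cd d, ‖herm z w‖^(2*n) * Real.exp (-‖w‖^2) = n.factorial * ‖z‖^(2*n) * K := by
  obtain ⟨K, hK, h⟩ := gauss_coord d
  refine ⟨K, hK, fun n z => ?_⟩
  let i : Fin d := ⟨0, hd⟩
  by_cases hz : z = 0
  · subst hz
    rcases Nat.eq_zero_or_pos n with rfl | hn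
    · simpa using h 0 i
    · simp [herm, hn.ne']
  have hz' : 0 < ‖z‖ := norm_pos_iff.2 hz
  obtain ⟨U, hU⟩ := exists_unitary i ((‖z‖⁻¹ : ℂ) • z) (by
    rw [norm_smul]; simp [hz'.ne'])
  have hUz : U z = (‖z‖ : ℂ) • EuclideanSpace.single i (1:ℂ) := by
    rw [← hU, map_smul, smul_smul, mul_inv_cancel₀ (by exact_mod_cast hz'.ne'), one_smul]
  have key : ∀ w, ‖herm z w‖^(2*n) * Real.exp (-‖w‖^2) =
      ‖z‖^(2*n) * (fun w : Cd d => ‖w i‖^(2*n) * Real.exp (-‖w‖^2)) (U w) := by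
    intro w
    have : herm z w = ‖z‖ * (starRingEnd ℂ) (U w i) := by
      rw [herm_eq_inner, ← U.inner_map_map, hUz, inner_smul_right,
        EuclideanSpace.inner_single_right, one_mul]
    simp only [this, norm_mul, U.norm_map, RCLike.norm_conj]
    simp [mul_pow]; ring
  have h3 := (unitary_mp U).integral_comp U.toHomeomorph.measurableEmbedding
    (fun w : Cd d => ‖w i‖^(2*n) * Real.exp (-‖w‖^2))
  rw [integral_congr_ae (ae_of_all _ key), integral_const_mul, h3, h]
  ring
end PartD

section PartE
open Set Module

lemma vol_ball_toReal_pos (d : ℕ) : 0 < ((volume (unitBall d))⁻¹).toReal := by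
  rw [ENNReal.toReal_inv]
  have h1 : volume (unitBall d) ≠ 0 := (measure_ball_pos _ _ one_pos).ne'
  have h2 : volume (unitBall d) ≠ ⊤ := measure_ball_lt_top.ne
  exact inv_pos.2 (ENNReal.toReal_pos h1 h2)

lemma normVol_integral {F : Type*} [NormedAddCommGroup F] [NormedSpace ℝ F] (d : ℕ) (f : Cd d → F) :
    ∫ w in unitBall d, f w ∂(normVol d) =
      ((volume (unitBall d))⁻¹).toReal • ∫ w in unitBall d, f w := by
  rw [normVol, Measure.restrict_smul, integral_smul_measure]

lemma finrank_Cd (d : ℕ) : finrank ℝ (Cd d) = 2 * d := by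
  rw [← Module.finrank_mul_finrank ℝ ℂ]; simp

lemma cCoef_pos (d : ℕ) {σ : ℝ} (hσ : -1 < σ) : 0 < cCoef d σ := by
  have hd : (0:ℝ) ≤ d := by positivity
  have h1 : 0 < Real.Gamma (d + σ + 1) := Real.Gamma_pos_of_pos (by linarith)
  have h2 : 0 < Real.Gamma (σ + 1) := Real.Gamma_pos_of_pos (by linarith)
  have h3 : 0 < Real.Gamma ((d:ℝ) + 1) := Real.Gamma_pos_of_pos (by linarith)
  unfold cCoef; positivity

lemma herm_smul_real {d : ℕ} (r : ℝ) (z w : Cd d) : herm z (r • w) = r * herm z w := by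
  simp [herm, Finset.mul_sum]
  refine Finset.sum_congr rfl fun j _ => by ring

lemma moment {d : ℕ} (hd : 0 < d) {σ : ℝ} (hσ : -1 < σ) (z : Cd d) (n : ℕ) :
    cCoef d σ * ∫ w in unitBall d, ‖herm z w‖^(2*n) * (1 - ‖w‖^2)^σ ∂(normVol d) =
      n.factorial * Real.Gamma (d + 1 + σ) / Real.Gamma (d + 1 + σ + n) * ‖z‖^(2*n) := by
  obtain ⟨K, hK, hm⟩ := gauss_moment hd
  have hd' : (0:ℝ) ≤ d := by positivity
  have h1 : 0 < Real.Gamma (d + σ + 1) := Real.Gamma_pos_of_pos (by linarith)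
  have h2 : 0 < Real.Gamma (σ + 1) := Real.Gamma_pos_of_pos (by linarith)
  have h3 : 0 < Real.Gamma ((d:ℝ) + 1) := Real.Gamma_pos_of_pos (by linarith)
  have hb := ball_vs_gauss (volume : Measure (Cd d)) hd (finrank_Cd d)
    (fun w => ‖herm z w‖^(2*n)) n (by
      intro r hr x
      simp only [herm_smul_real, norm_mul, mul_pow, Complex.norm_real, Real.norm_of_nonneg hr.le]) hσ
  have hv := ball_vs_gauss (volume : Measure (Cd d)) hd (finrank_Cd d)
    (fun w => ‖herm (0 : Cd d) w‖^(2*0)) 0 (by simp) (σ := 0) (by norm_num)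
  rw [hm] at hb hv
  simp only [mul_zero, pow_zero, Real.rpow_zero, one_mul, mul_one, Nat.factorial_zero, Nat.cast_one,
    Nat.cast_zero, add_zero, zero_add, Real.Gamma_one] at hv
  have hv' : ((volume (unitBall d))⁻¹).toReal = (K * (1 / Real.Gamma (d+1)))⁻¹ := by
    rw [ENNReal.toReal_inv, ← hv]
    simp [unitBall, Measure.real]
  rw [normVol_integral, hv', unitBall, hb, smul_eq_mul, cCoef]
  rw [show (d:ℝ) + n + σ + 1 = d + 1 + σ + n by ring, show (d:ℝ) + σ + 1 = d + 1 + σ by ring]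
  rw [show (d:ℝ) + σ + 1 = d + 1 + σ by ring] at h1
  have h4 : 0 < Real.Gamma (d + 1 + σ + n) := Real.Gamma_pos_of_pos (by
    have : (0:ℝ) ≤ n := by positivity
    linarith)
  field_simp

lemma weight_integrable {d : ℕ} (hd : 0 < d) {σ : ℝ} (hσ : -1 < σ) :
    Integrable (fun w : Cd d => (1 - ‖w‖^2)^σ) ((normVol d).restrict (unitBall d)) := by
  have h := moment hd hσ 0 0
  by_contra hn
  simp only [mul_zero, pow_zero, one_mul, mul_one, Nat.cast_zero, add_zero] at h
  rw [integral_undef hn, mul_zero] at h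
  have hd' : (0:ℝ) ≤ d := by positivity
  have h1 : 0 < Real.Gamma (d + 1 + σ) := Real.Gamma_pos_of_pos (by linarith)
  rw [Nat.factorial_zero, Nat.cast_one, one_mul, div_self h1.ne'] at h
  exact zero_ne_one h

lemma weight_integral {d : ℕ} (hd : 0 < d) {σ : ℝ} (hσ : -1 < σ) :
    cCoef d σ * ∫ w in unitBall d, (1 - ‖w‖^2)^σ ∂(normVol d) = 1 := by
  have h := moment hd hσ 0 0
  simp only [mul_zero, pow_zero, one_mul, mul_one, Nat.cast_zero, add_zero] at h
  have hd' : (0:ℝ) ≤ d := by positivity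
  have h1 : 0 < Real.Gamma (d + 1 + σ) := Real.Gamma_pos_of_pos (by linarith)
  rw [Nat.factorial_zero, Nat.cast_one, one_mul, div_self h1.ne'] at h
  exact h

lemma herm_continuous {d : ℕ} (z : Cd d) : Continuous (fun w => herm z w) := by
  simp_rw [herm_eq_inner]; fun_prop

lemma norm_herm_le {d : ℕ} (z w : Cd d) : ‖herm z w‖ ≤ ‖z‖ * ‖w‖ := by
  rw [herm_eq_inner, mul_comm]; exact norm_inner_le_norm _ _

lemma norm_herm_le' {d : ℕ} (z : Cd d) {w : Cd d} (hw : w ∈ unitBall d) : ‖herm z w‖ ≤ ‖z‖ := by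
  have : ‖w‖ < 1 := by simpa [unitBall] using hw
  exact (norm_herm_le z w).trans (mul_le_of_le_one_right (norm_nonneg _) this.le)

lemma measurableSet_unitBall (d : ℕ) : MeasurableSet (unitBall d) := measurableSet_ball

lemma ae_unitBall {d : ℕ} {p : Cd d → Prop} (h : ∀ w ∈ unitBall d, p w) :
    ∀ᵐ w ∂((normVol d).restrict (unitBall d)), p w :=
  (ae_restrict_mem (measurableSet_unitBall d)).mono h

/-- bounded measurable times weight is integrable -/
lemma weight_mul_integrable {d : ℕ} (hd : 0 < d) {σ : ℝ} (hσ : -1 < σ) {F : Type*}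
    [NormedAddCommGroup F] [NormedSpace ℝ F]
    {f : Cd d → F} (hf : AEStronglyMeasurable f ((normVol d).restrict (unitBall d)))
    (C : ℝ) (hC : ∀ w ∈ unitBall d, ‖f w‖ ≤ C) :
    Integrable (fun w : Cd d => ((1 - ‖w‖^2)^σ : ℝ) • f w) ((normVol d).restrict (unitBall d)) := by
  exact (weight_integrable hd hσ).smul_bdd C hf (ae_unitBall hC)

lemma weight_nonneg {d : ℕ} (σ : ℝ) {w : Cd d} (hw : w ∈ unitBall d) : 0 ≤ (1 - ‖w‖^2)^σ := by
  have : ‖w‖ < 1 := by simpa [unitBall] using hw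
  exact Real.rpow_nonneg (by nlinarith [norm_nonneg w]) _

lemma orth {d : ℕ} (σ : ℝ) (z : Cd d) {n m : ℕ} (hnm : n ≠ m) :
    ∫ w in unitBall d, ((1 - ‖w‖^2)^σ : ℝ) • (herm z w^n * (starRingEnd ℂ) (herm z w^m)) ∂(normVol d)
      = 0 := by
  rw [normVol_integral]
  set I := ∫ w in unitBall d, ((1 - ‖w‖^2)^σ : ℝ) • (herm z w^n * (starRingEnd ℂ) (herm z w^m)) with hI
  -- rotation
  let t : ℝ := Real.pi / ((n:ℝ) - m)
  have hnm' : (n:ℝ) - m ≠ 0 := sub_ne_zero.2 (by exact_mod_cast hnm)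
  have ht : t * n - t * m = Real.pi := by
    simp only [t]; field_simp
  let c : ℂ := Complex.exp (t * Complex.I)
  have hc : ‖c‖ = 1 := Complex.norm_exp_ofReal_mul_I t
  have hc0 : c ≠ 0 := Complex.exp_ne_zero _
  let U : Cd d ≃ₗᵢ[ℂ] Cd d := ⟨LinearEquiv.smulOfNeZero ℂ (Cd d) c hc0, fun w => by
    simp [norm_smul, hc]⟩
  have hU : ∀ w, U w = c • w := fun w => rfl
  have hcc : (starRingEnd ℂ) c ^ n * c ^ m = -1 := by
    simp only [c]
    rw [← Complex.exp_conj, ← Complex.exp_nat_mul, ← Complex.exp_nat_mul, ← Complex.exp_add]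
    have : (n:ℂ) * (starRingEnd ℂ) (t * Complex.I) + m * (t * Complex.I) = -(Real.pi * Complex.I) := by
      rw [← ht]; simp; ring
    rw [this, Complex.exp_neg, Complex.exp_pi_mul_I]; norm_num
  have h := (unitary_mp U).setIntegral_preimage_emb U.toHomeomorph.measurableEmbedding
    (fun w => ((1 - ‖w‖^2)^σ : ℝ) • (herm z w^n * (starRingEnd ℂ) (herm z w^m))) (unitBall d)
  have hpre : U ⁻¹' (unitBall d) = unitBall d := by
    ext w; simp [unitBall]
  rw [hpre, ← hI] at h
  have h2 : ∀ w, ((1 - ‖U w‖^2)^σ : ℝ) • (herm z (U w)^n * (starRingEnd ℂ) (herm z (U w)^m)) =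
      -(((1 - ‖w‖^2)^σ : ℝ) • (herm z w^n * (starRingEnd ℂ) (herm z w^m))) := by
    intro w
    rw [U.norm_map, hU, ← smul_neg]
    congr 1
    have : herm z (c • w) = (starRingEnd ℂ) c * herm z w := by
      simp [herm, Finset.mul_sum]
      refine Finset.sum_congr rfl fun j _ => by ring
    rw [this, mul_pow, mul_pow, map_mul, map_pow _ ((starRingEnd ℂ) c), Complex.conj_conj]
    linear_combination (herm z w ^ n * (starRingEnd ℂ) (herm z w ^ m)) * hcc
  have h3 : -I = I := by
    rw [hI, ← integral_neg, ← integral_congr_ae (ae_of_all _ h2), ← hI]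
    exact h
  have : I = 0 := by
    have h4 : (2:ℂ) * I = 0 := by linear_combination -h3
    simpa using h4
  rw [this, smul_zero]

lemma J_eq {d : ℕ} (hd : 0 < d) {σ : ℝ} (hσ : -1 < σ) {l : ℝ} (hl : l = d + 1 + σ) {z : Cd d}
    (hz : ‖z‖ < 1) :
    cCoef d σ * ∫ w in unitBall d, (1 - ‖w‖^2)^σ * ‖1 - herm z w‖^(-(l+1)) ∂(normVol d) =
      Real.Gamma l / Real.Gamma ((l+1)/2)^2 * ∑' n, qs l n * (‖z‖^2)^n := by
  have hd' : (1:ℝ) ≤ d := by exact_mod_cast hd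
  have hl0 : 0 < l := by linarith
  set β := (l+1)/2 with hβ
  have hβ0 : 0 < β := by positivity
  have hΓβ := Real.Gamma_pos_of_pos hβ0
  let a : ℕ → ℝ := fun n => Real.Gamma (β+n) / (Real.Gamma β * n.factorial)
  have ha0 : ∀ n, 0 ≤ a n := fun n => by
    have : 0 < Real.Gamma (β + n) := Real.Gamma_pos_of_pos (by positivity)
    positivity
  have hasum : ∀ {r : ℝ}, 0 ≤ r → r < 1 → Summable (fun n => a n * r^n) := by
    intro r h0 h1
    have := (binom_hasSum hβ0 (u := (r:ℂ)) (by simpa [abs_of_nonneg h0] using h1)).summable.norm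
    refine this.congr fun n => ?_
    have h := ha0 n
    simp only [norm_mul, Complex.norm_real, norm_pow, Real.norm_of_nonneg h0]
    rw [Real.norm_of_nonneg h]
  let c : ℕ → Cd d → ℂ := fun n w => (a n : ℂ) * herm z w ^ n
  let F : ℕ × ℕ → Cd d → ℂ := fun p w => ((1 - ‖w‖^2)^σ : ℝ) • (c p.1 w * (starRingEnd ℂ) (c p.2 w))
  have hcn : ∀ n, ∀ w ∈ unitBall d, ‖c n w‖ ≤ a n * ‖z‖^n := by
    intro n w hw
    simp only [c, norm_mul, norm_pow, Complex.norm_real, Real.norm_of_nonneg (ha0 n)]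
    have := norm_herm_le' z hw
    have := ha0 n
    gcongr
  have hcc : ∀ n, Continuous (c n) := fun n => by
    have := herm_continuous z
    simp only [c]; fun_prop
  have hFint : ∀ p, Integrable (F p) ((normVol d).restrict (unitBall d)) := by
    intro p
    refine weight_mul_integrable hd hσ ?_ ((a p.1 * ‖z‖^p.1) * (a p.2 * ‖z‖^p.2)) ?_
    · have := hcc p.1
      have := hcc p.2
      exact Continuous.aestronglyMeasurable (by fun_prop)
    · intro w hw
      rw [norm_mul, RCLike.norm_conj]
      have h1 := hcn p.1 w hw
      have h2 := hcn p.2 w hw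
      gcongr
  have hFs : Summable fun p => ∫ w in unitBall d, ‖F p w‖ ∂(normVol d) := by
    have hs := hasum (norm_nonneg z) hz
    have hs2 := hs.mul_of_nonneg hs (fun n => by have := ha0 n; positivity) (fun n => by have := ha0 n; positivity)
    have hs3 := hs2.mul_left (∫ w in unitBall d, (1 - ‖w‖^2)^σ ∂(normVol d))
    refine Summable.of_nonneg_of_le (fun p => integral_nonneg fun w => norm_nonneg _) (fun p => ?_) hs3
    rw [← integral_mul_const]
    refine integral_mono_ae (hFint p).norm ((weight_integrable hd hσ).mul_const _) (ae_unitBall fun w hw => ?_)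
    have h1 := hcn p.1 w hw
    have h2 := hcn p.2 w hw
    have h3 := weight_nonneg σ hw
    simp only [F, norm_smul, norm_mul, RCLike.norm_conj, Real.norm_of_nonneg h3]
    gcongr
  have hsum := hasSum_integral_of_summable_integral_norm hFint hFs
  -- pointwise sum
  have hpt : ∀ w ∈ unitBall d, ∑' p, F p w =
      (((1 - ‖w‖^2)^σ * ‖1 - herm z w‖^(-(l+1)) : ℝ) : ℂ) := by
    intro w hw
    have hu : ‖herm z w‖ < 1 := (norm_herm_le' z hw).trans_lt hz
    have hS := binom_hasSum hβ0 hu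
    have hn : Summable fun n => ‖c n w‖ := hS.summable.norm
    have hn2 : Summable fun n => ‖(starRingEnd ℂ) (c n w)‖ := by
      simpa only [RCLike.norm_conj] using hn
    have h1 : ∑' n, c n w = 1 / (1 - herm z w)^(β:ℂ) := hS.tsum_eq
    have h2 : ∑' n, (starRingEnd ℂ) (c n w) = (starRingEnd ℂ) (1 / (1 - herm z w)^(β:ℂ)) := by
      rw [← h1, Complex.conj_tsum]
    have h3 := tsum_mul_tsum_of_summable_norm hn hn2
    have hpos : 0 < ‖1 - herm z w‖ := by
      have := norm_sub_norm_le (1:ℂ) (herm z w)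
      rw [norm_one] at this
      linarith
    have h5 : ∑' p, F p w = (((1 - ‖w‖^2)^σ : ℝ) : ℂ) * ∑' p : ℕ × ℕ, c p.1 w * (starRingEnd ℂ) (c p.2 w) := by
      rw [← tsum_mul_left]
      exact tsum_congr fun p => Complex.real_smul
    rw [h5, ← h3, h1, h2, Complex.mul_conj', norm_div, norm_one, Complex.norm_cpow_real]
    push_cast
    congr 1
    norm_cast
    rw [div_pow, one_pow, ← Real.rpow_natCast, ← Real.rpow_mul hpos.le, one_div, ← Real.rpow_neg hpos.le]
    congr 1
    push_cast
    rw [hβ]; ring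
  have hval : ∀ p : ℕ × ℕ, p.1 ≠ p.2 → ∫ w in unitBall d, F p w ∂(normVol d) = 0 := by
    intro p hp
    have := orth σ z hp
    have h2 : ∀ w, F p w = (a p.1 * a p.2 : ℂ) *
      (((1 - ‖w‖^2)^σ : ℝ) • (herm z w^p.1 * (starRingEnd ℂ) (herm z w^p.2))) := by
      intro w
      simp only [F, c, map_mul, Complex.conj_ofReal, Complex.real_smul]; ring
    rw [integral_congr_ae (ae_of_all _ h2), integral_const_mul, this, mul_zero]
  have hdiag : ∀ n, ∫ w in unitBall d, F (n,n) w ∂(normVol d) =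
      ((a n^2 * ∫ w in unitBall d, ‖herm z w‖^(2*n) * (1 - ‖w‖^2)^σ ∂(normVol d) : ℝ) : ℂ) := by
    intro n
    rw [← integral_const_mul, ← integral_complex_ofReal]
    refine integral_congr_ae (ae_of_all _ fun w => ?_)
    simp only [F, c, map_mul, Complex.conj_ofReal, Complex.real_smul, map_pow]
    push_cast
    have := Complex.mul_conj' (herm z w)
    rw [pow_mul, ← this]
    ring
  have hinj : Function.Injective (fun n : ℕ => (n,n)) := fun a b h => (Prod.ext_iff.1 h).1
  rw [integral_congr_ae (ae_unitBall hpt), integral_complex_ofReal,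
    ← hinj.hasSum_iff (by
      rintro ⟨p, q⟩ hp
      apply hval
      intro (h : p = q)
      subst h
      exact hp ⟨p, rfl⟩)] at hsum
  simp only [Function.comp_def, hdiag] at hsum
  rw [Complex.hasSum_ofReal] at hsum
  rw [← hsum.tsum_eq, ← tsum_mul_left, ← tsum_mul_left]
  refine tsum_congr fun n => ?_
  have hm := moment hd hσ z n
  rw [← hl] at hm
  have h4 : 0 < Real.Gamma (l + n) := Real.Gamma_pos_of_pos (by positivity)
  rw [mul_left_comm, hm]
  simp only [a, qs, ← hβ, ← pow_mul]
  field_simp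
end PartE

section PartF
open Set Module Topology

/-- The derivative of the weighted kernel in `z`. -/
noncomputable def dker {d : ℕ} (σ l : ℝ) (G : Cd d → ℂ) (z w : Cd d) : Cd d →L[ℂ] ℂ :=
  ((1 - ‖w‖^2)^σ : ℝ) • (((l:ℂ) * (1 - herm z w)^(-((l+1:ℝ):ℂ)) * G w) • innerSL ℂ w)

lemma one_sub_herm_lower {d : ℕ} {z w : Cd d} (hw : w ∈ unitBall d) :
    1 - ‖z‖ ≤ ‖1 - herm z w‖ := by
  have h1 := norm_sub_norm_le (1:ℂ) (herm z w)
  have h2 := norm_herm_le' z hw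
  rw [norm_one] at h1
  linarith

lemma one_sub_herm_slit {d : ℕ} {z w : Cd d} (hz : ‖z‖ < 1) (hw : w ∈ unitBall d) :
    1 - herm z w ∈ slitPlane := by
  left
  have h2 := norm_herm_le' z hw
  have h3 := Complex.re_le_norm (herm z w)
  simp; linarith

lemma herm_measurable {d : ℕ} (z : Cd d) : Measurable (fun w => herm z w) :=
  (herm_continuous z).measurable

lemma norm_ofReal_cpow_neg {x : ℂ} {s c : ℝ} (hs : 0 ≤ s) (hc : 0 < c) (hx : c ≤ ‖x‖) :
    ‖x ^ (-(s:ℂ))‖ ≤ c^(-s) := by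
  have : (-(s:ℂ)) = ((-s:ℝ):ℂ) := by push_cast; rfl
  rw [this, Complex.norm_cpow_real]
  exact Real.rpow_le_rpow_of_nonpos hc hx (by linarith)

lemma dker_integrable {d : ℕ} (hd : 0 < d) {σ : ℝ} (hσ : -1 < σ) {l : ℝ} (hl : 0 < l)
    {G : Cd d → ℂ} (hG : Measurable G) (hG1 : ∀ w, ‖G w‖ ≤ 1) {z : Cd d} (hz : ‖z‖ < 1) :
    Integrable (dker σ l G z) ((normVol d).restrict (unitBall d)) := by
  refine weight_mul_integrable hd hσ ?_ (l * (1 - ‖z‖)^(-(l+1))) ?_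
  · have h1 : Measurable fun w : Cd d => ((l:ℂ) * (1 - herm z w)^(-((l+1:ℝ):ℂ)) * G w) := by
      have := herm_measurable z
      fun_prop
    have h2 : Continuous fun w : Cd d => innerSL ℂ w := (innerSL ℂ).continuous
    exact h1.aestronglyMeasurable.smul h2.aestronglyMeasurable
  · intro w hw
    have hw' : ‖w‖ < 1 := by simpa [unitBall] using hw
    rw [norm_smul, norm_mul, norm_mul, innerSL_apply_norm, Complex.norm_real, Real.norm_of_nonneg hl.le]
    have h1 := norm_ofReal_cpow_neg (s := l+1) (by linarith) (sub_pos.2 hz) (one_sub_herm_lower hw)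
    have h2 := hG1 w
    calc _ ≤ l * (1 - ‖z‖)^(-(l+1)) * 1 * 1 := by gcongr
      _ = _ := by ring

lemma bergman_hasFDerivAt {d : ℕ} (hd : 0 < d) {σ : ℝ} (hσ : -1 < σ) {l : ℝ} (hl : l = d + 1 + σ)
    {G : Cd d → ℂ} (hG : Measurable G) (hG1 : ∀ w, ‖G w‖ ≤ 1) {z : Cd d} (hz : ‖z‖ < 1) :
    HasFDerivAt (bergman d σ G)
      ((cCoef d σ : ℂ) • ∫ w in unitBall d, dker σ l G z w ∂(normVol d)) z := by
  have hl0 : 0 < l := by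
    have hd' : (1:ℝ) ≤ d := by exact_mod_cast hd
    linarith
  have hker : ∀ x w, bergKer d σ x w * G w =
      ((1 - ‖w‖^2)^σ : ℝ) • ((1 - herm x w)^(-(l:ℂ)) * G w) := by
    intro x w
    rw [bergKer, ← hl, Complex.cpow_neg, Complex.real_smul]
    ring
  unfold bergman
  apply HasFDerivAt.const_mul
  simp_rw [hker]
  set e := (1 - ‖z‖)/2 with he
  have he0 : 0 < e := by linarith
  have hsub : ∀ x ∈ ball z e, ‖x‖ < 1 - e := by
    intro x hx
    have h1 : ‖x - z‖ < e := by simpa [dist_eq_norm] using hx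
    have h2 := norm_sub_norm_le x z
    linarith
  have hmeas : ∀ x : Cd d, Measurable fun w => (1 - herm x w)^(-(l:ℂ)) * G w := fun x => by
    have := herm_measurable x
    fun_prop
  refine hasFDerivAt_integral_of_dominated_of_fderiv_le (F' := fun x w => dker σ l G x w)
    (bound := fun w => (1 - ‖w‖^2)^σ * (l * e^(-(l+1)))) (ball_mem_nhds z he0) ?_ ?_ ?_ ?_ ?_ ?_
  · refine Filter.Eventually.of_forall fun x => ?_
    exact (weight_integrable hd hσ).aestronglyMeasurable.smul (hmeas x).aestronglyMeasurable
  · refine weight_mul_integrable hd hσ (hmeas z).aestronglyMeasurable ((1 - ‖z‖)^(-l)) ?_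
    intro w hw
    rw [norm_mul]
    have h1 := norm_ofReal_cpow_neg (s := l) hl0.le (sub_pos.2 hz) (one_sub_herm_lower hw)
    calc _ ≤ (1 - ‖z‖)^(-l) * 1 := by gcongr; exact hG1 w
      _ = _ := mul_one _
  · exact (dker_integrable hd hσ hl0 hG hG1 hz).aestronglyMeasurable
  · refine ae_unitBall fun w hw x hx => ?_
    have hw' : ‖w‖ < 1 := by simpa [unitBall] using hw
    have h3 := weight_nonneg σ hw
    have hx' := hsub x hx
    unfold dker
    rw [norm_smul, norm_smul, norm_mul, norm_mul, innerSL_apply_norm, Complex.norm_real, Real.norm_of_nonneg hl0.le, Real.norm_of_nonneg h3]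
    have h1 := norm_ofReal_cpow_neg (s := l+1) (by linarith) he0
      (le_trans (by linarith) (one_sub_herm_lower (z := x) hw))
    have h2 := hG1 w
    calc _ ≤ (1 - ‖w‖^2)^σ * (l * e^(-(l+1)) * 1 * 1) := by gcongr
      _ = _ := by ring
  · exact (weight_integrable hd hσ).mul_const _
  · refine ae_unitBall fun w hw x hx => ?_
    have hx' := hsub x hx
    have h1 : HasFDerivAt (fun x : Cd d => 1 - herm x w) (-(innerSL ℂ w)) x := by
      simp_rw [herm_eq_inner]
      exact ((innerSL ℂ w).hasFDerivAt).const_sub 1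
    have h2 := (hasStrictDerivAt_cpow_const (c := -(l:ℂ))
      (one_sub_herm_slit (z := x) (by linarith) hw)).hasDerivAt
    have h3 := ((h2.comp_hasFDerivAt x h1).mul_const (G w)).const_smul (((1 - ‖w‖^2)^σ : ℝ))
    refine h3.congr_fderiv ?_
    ext v
    have : -(l:ℂ) - 1 = -((l+1:ℝ):ℂ) := by push_cast; ring
    simp [dker, this]
    ring_nf
    tauto

lemma bergman_fderiv_apply {d : ℕ} (hd : 0 < d) {σ : ℝ} (hσ : -1 < σ) {l : ℝ} (hl : l = d + 1 + σ)
    {G : Cd d → ℂ} (hG : Measurable G) (hG1 : ∀ w, ‖G w‖ ≤ 1) {z : Cd d} (hz : ‖z‖ < 1) (v : Cd d) :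
    fderiv ℂ (bergman d σ G) z v =
      (cCoef d σ : ℂ) * ∫ w in unitBall d, ((1 - ‖w‖^2)^σ : ℝ) •
        ((l:ℂ) * (1 - herm z w)^(-((l+1:ℝ):ℂ)) * G w * herm v w) ∂(normVol d) := by
  have hl0 : 0 < l := by
    have hd' : (1:ℝ) ≤ d := by exact_mod_cast hd
    linarith
  rw [(bergman_hasFDerivAt hd hσ hl hG hG1 hz).fderiv, smul_apply,
    ContinuousLinearMap.integral_apply (dker_integrable hd hσ hl0 hG hG1 hz), smul_eq_mul]
  congr 1

lemma pd_sum {d : ℕ} (f : Cd d → ℂ) (z v : Cd d) :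
    fderiv ℂ f z v = ∑ j, v j * pd d j f z := by
  have : v = ∑ j, v j • EuclideanSpace.single j (1:ℂ) := by
    ext i; simp [Finset.sum_apply, Pi.single_apply]
  conv_lhs => rw [this]
  simp [pd, map_sum]

end PartF

section PartG
open Set Module Topology

lemma lp_le_l2 {d : ℕ} (a : Fin d → ℝ) (ha : ∀ j, 0 ≤ a j) {p : ℝ} (hp : 2 ≤ p) :
    (∑ j, a j ^ p) ^ (1/p) ≤ Real.sqrt (∑ j, a j ^ 2) := by
  set S := Real.sqrt (∑ j, a j ^ 2) with hS
  have hS0 : 0 ≤ S := Real.sqrt_nonneg _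
  have hSS : S^2 = ∑ j, a j ^ 2 := Real.sq_sqrt (Finset.sum_nonneg fun j _ => sq_nonneg _)
  have hle : ∀ j, a j ≤ S := fun j =>
    Real.le_sqrt_of_sq_le (Finset.single_le_sum (f := fun j => a j ^ 2) (fun j _ => sq_nonneg _) (Finset.mem_univ j))
  have hsplit : ∀ x : ℝ, 0 ≤ x → x^p = x^2 * x^(p-2) := by
    intro x hx
    rw [← Real.rpow_natCast, ← Real.rpow_add_of_nonneg hx (by norm_num) (by linarith)]
    congr 1; push_cast; ring
  have h : ∑ j, a j ^ p ≤ S ^ p := by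
    rw [hsplit S hS0, hSS, Finset.sum_mul]
    refine Finset.sum_le_sum fun j _ => ?_
    rw [hsplit _ (ha j)]
    gcongr
    · exact ha j
    · exact hle j
  calc _ ≤ (S^p)^(1/p) := Real.rpow_le_rpow (Finset.sum_nonneg fun j _ => Real.rpow_nonneg (ha j) _) h (by positivity)
    _ = S := by rw [← Real.rpow_mul hS0, mul_one_div_cancel (by linarith), Real.rpow_one]

lemma lp_le_const_l2 {d : ℕ} (a : Fin d → ℝ) (ha : ∀ j, 0 ≤ a j) {p : ℝ} (hp : 1 ≤ p) (hp2 : p < 2) :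
    (∑ j, a j ^ p) ^ (1/p) ≤ (d:ℝ)^(1/p - 1/2) * Real.sqrt (∑ j, a j ^ 2) := by
  have hp0 : 0 < p := by linarith
  have h := Real.rpow_sum_le_const_mul_sum_rpow (Finset.univ : Finset (Fin d)) (fun j => a j ^ p)
    (p := 2/p) (by rw [le_div_iff₀ hp0]; linarith)
  have h2 : ∀ j, |a j ^ p| ^ (2/p) = a j ^ 2 := by
    intro j
    rw [abs_of_nonneg (Real.rpow_nonneg (ha j) _), ← Real.rpow_mul (ha j), mul_div_cancel₀ _ hp0.ne']
    norm_cast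
  have h3 : ∑ j, |a j ^ p| = ∑ j, a j ^ p :=
    Finset.sum_congr rfl fun j _ => abs_of_nonneg (Real.rpow_nonneg (ha j) _)
  simp only [h2, h3, Finset.card_univ, Fintype.card_fin] at h
  have h0 : 0 ≤ ∑ j, a j ^ p := Finset.sum_nonneg fun j _ => Real.rpow_nonneg (ha j) _
  have h4 := Real.rpow_le_rpow (Real.rpow_nonneg h0 _) h (show (0:ℝ) ≤ 1/2 by norm_num)
  rw [← Real.rpow_mul h0, Real.mul_rpow (by positivity) (Finset.sum_nonneg fun j _ => sq_nonneg _),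
    ← Real.rpow_mul (by positivity), ← Real.sqrt_eq_rpow] at h4
  convert h4 using 2
  · field_simp
  · congr 1; field_simp

lemma l1_le_lp {d : ℕ} (a : Fin d → ℝ) (ha : ∀ j, 0 ≤ a j) {p : ℝ} (hp : 1 ≤ p) :
    ∑ j, a j ≤ (d:ℝ)^(1 - 1/p) * (∑ j, a j ^ p) ^ (1/p) := by
  have hp0 : 0 < p := by linarith
  have h := Real.rpow_sum_le_const_mul_sum_rpow (Finset.univ : Finset (Fin d)) a hp
  simp only [abs_of_nonneg (ha _), Finset.card_univ, Fintype.card_fin] at h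
  have h0 : 0 ≤ ∑ j, a j := Finset.sum_nonneg fun j _ => ha j
  have h4 := Real.rpow_le_rpow (Real.rpow_nonneg h0 _) h (show (0:ℝ) ≤ 1/p by positivity)
  rw [← Real.rpow_mul h0, Real.mul_rpow (by positivity) (Finset.sum_nonneg fun j _ => Real.rpow_nonneg (ha j) _),
    ← Real.rpow_mul (by positivity), mul_one_div_cancel hp0.ne', Real.rpow_one] at h4
  convert h4 using 2
  congr 1; field_simp

lemma single_le_lp {d : ℕ} (a : Fin d → ℝ) (ha : ∀ j, 0 ≤ a j) {p : ℝ} (hp : 1 ≤ p) (i : Fin d) :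
    a i ≤ (∑ j, a j ^ p) ^ (1/p) := by
  have hp0 : 0 < p := by linarith
  have h : a i ^ p ≤ ∑ j, a j ^ p :=
    Finset.single_le_sum (f := fun j => a j ^ p) (fun j _ => Real.rpow_nonneg (ha j) _) (Finset.mem_univ i)
  have h4 := Real.rpow_le_rpow (Real.rpow_nonneg (ha i) _) h (show (0:ℝ) ≤ 1/p by positivity)
  rwa [← Real.rpow_mul (ha i), mul_one_div_cancel hp0.ne', Real.rpow_one] at h4

lemma qs_limit {l : ℝ} (hl : 0 < l) :
    Filter.Tendsto (fun x : ℝ => (1 - x) * ∑' n, qs l n * x^n) (𝓝[<] 1) (𝓝 1) := by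
  rw [tendsto_order]
  refine ⟨fun c hc => qs_tsum_tendsto hl hc, fun c hc => ?_⟩
  have : ∀ᶠ x in 𝓝[<] (1:ℝ), 0 < x :=
    (nhdsWithin_le_nhds (lt_mem_nhds (one_pos)))
  filter_upwards [this, self_mem_nhdsWithin] with x h0 h1
  exact (qs_upper hl h0.le h1).trans_lt hc

lemma pt_ineq {l ε t : ℝ} (hl : 0 < l) (hε : 0 < ε) (ht : 0 < t) :
    t^(-l) ≤ ε * t^(-(l+1)) + ε^(-l) := by
  rcases le_total t ε with h | h
  · have h1 : t^(-l) = t * t^(-(l+1)) := by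
      conv_rhs => rw [← Real.rpow_one t, ← Real.rpow_mul ht.le, ← Real.rpow_add ht]
      congr 1; ring
    have h2 : 0 ≤ ε^(-l) := by positivity
    have h3 : 0 ≤ t^(-(l+1)) := by positivity
    rw [h1]
    nlinarith
  · have h1 := Real.rpow_le_rpow_of_nonpos hε h (show -l ≤ 0 by linarith)
    have h3 : 0 ≤ ε * t^(-(l+1)) := by positivity
    linarith

end PartG

section PartI
open Set Module Topology

lemma kernel_integrable {d : ℕ} (hd : 0 < d) {σ : ℝ} (hσ : -1 < σ) {l : ℝ} (hl : 0 < l)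
    {z : Cd d} (hz : ‖z‖ < 1) :
    Integrable (fun w => (1 - ‖w‖^2)^σ * ‖1 - herm z w‖^(-(l+1))) ((normVol d).restrict (unitBall d)) := by
  refine weight_mul_integrable hd hσ (f := fun w => ‖1 - herm z w‖^(-(l+1))) ?_ ((1 - ‖z‖)^(-(l+1))) ?_
  · have := herm_measurable z
    exact Measurable.aestronglyMeasurable (by fun_prop)
  · intro w hw
    rw [Real.norm_of_nonneg (by positivity)]
    exact Real.rpow_le_rpow_of_nonpos (sub_pos.2 hz) (one_sub_herm_lower hw) (by linarith)

lemma fderiv_bound {d : ℕ} (hd : 0 < d) {σ : ℝ} (hσ : -1 < σ) {l : ℝ} (hl : l = d + 1 + σ)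
    {G : Cd d → ℂ} (hG : Measurable G) (hG1 : ∀ w, ‖G w‖ ≤ 1) {z : Cd d} (hz : ‖z‖ < 1) (v : Cd d) :
    (1 - ‖z‖^2) * ‖fderiv ℂ (bergman d σ G) z v‖ ≤
      (Real.Gamma (l+1) / Real.Gamma ((l+1)/2)^2) * ‖v‖ := by
  have hl0 : 0 < l := by
    have hd' : (1:ℝ) ≤ d := by exact_mod_cast hd
    linarith
  have hc := cCoef_pos d hσ
  rw [bergman_fderiv_apply hd hσ hl hG hG1 hz, norm_mul, Complex.norm_real, Real.norm_of_nonneg hc.le]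
  have hz2 : ‖z‖^2 < 1 := by nlinarith [norm_nonneg z]
  have h1 : ‖∫ w in unitBall d, ((1 - ‖w‖^2)^σ : ℝ) •
        ((l:ℂ) * (1 - herm z w)^(-((l+1:ℝ):ℂ)) * G w * herm v w) ∂(normVol d)‖ ≤
      ∫ w in unitBall d, ((1 - ‖w‖^2)^σ * ‖1 - herm z w‖^(-(l+1))) * (l * ‖v‖) ∂(normVol d) := by
    refine norm_integral_le_of_norm_le ((kernel_integrable hd hσ hl0 hz).mul_const _)
      (ae_unitBall fun w hw => ?_)
    have h3 := weight_nonneg σ hw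
    have h4 := norm_herm_le' v hw
    have h5 := hG1 w
    have h6 : (-((l+1:ℝ):ℂ)) = ((-(l+1):ℝ):ℂ) := by push_cast; ring
    rw [norm_smul, norm_mul, norm_mul, norm_mul, h6, Complex.norm_cpow_real, Complex.norm_real,
      Real.norm_of_nonneg hl0.le, Real.norm_of_nonneg h3]
    calc _ ≤ (1 - ‖w‖^2)^σ * (l * ‖1 - herm z w‖^(-(l+1)) * 1 * ‖v‖) := by gcongr
      _ = _ := by ring
  rw [integral_mul_const] at h1
  have hJ := J_eq hd hσ hl hz
  have hq := qs_upper hl0 (sq_nonneg ‖z‖) hz2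
  have hΓ : 0 < Real.Gamma l := Real.Gamma_pos_of_pos hl0
  have hΓ2 : 0 < Real.Gamma ((l+1)/2) := Real.Gamma_pos_of_pos (by linarith)
  set J := ∫ w in unitBall d, ((1 - ‖w‖^2)^σ * ‖1 - herm z w‖^(-(l+1))) ∂(normVol d)
  set Q := ∑' n, qs l n * (‖z‖^2)^n
  have hz3 : 0 ≤ 1 - ‖z‖^2 := by linarith
  calc _ ≤ (1 - ‖z‖^2) * (cCoef d σ * (J * (l * ‖v‖))) := by gcongr
    _ = (Real.Gamma l / Real.Gamma ((l+1)/2)^2 * (l * ‖v‖)) * ((1 - ‖z‖^2) * Q) := by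
      rw [← mul_assoc (cCoef d σ), hJ]; ring
    _ ≤ (Real.Gamma l / Real.Gamma ((l+1)/2)^2 * (l * ‖v‖)) * 1 := by gcongr
    _ = _ := by rw [Real.Gamma_add_one hl0.ne']; ring

lemma grad_bound {d : ℕ} (hd : 0 < d) {σ : ℝ} (hσ : -1 < σ) {l : ℝ} (hl : l = d + 1 + σ)
    {G : Cd d → ℂ} (hG : Measurable G) (hG1 : ∀ w, ‖G w‖ ≤ 1) {z : Cd d} (hz : ‖z‖ < 1) :
    (1 - ‖z‖^2) * Real.sqrt (∑ j, ‖pd d j (bergman d σ G) z‖^2) ≤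
      Real.Gamma (l+1) / Real.Gamma ((l+1)/2)^2 := by
  let v : Cd d := WithLp.toLp 2 (fun j => (starRingEnd ℂ) (pd d j (bergman d σ G) z))
  have hv : ‖v‖ = Real.sqrt (∑ j, ‖pd d j (bergman d σ G) z‖^2) := by
    rw [EuclideanSpace.norm_eq]
    simp only [v, RCLike.norm_conj]
  have h := fderiv_bound hd hσ hl hG hG1 hz v
  have h2 : ‖fderiv ℂ (bergman d σ G) z v‖ = ‖v‖^2 := by
    rw [pd_sum, hv, Real.sq_sqrt (by positivity)]
    have : ∑ j, v j * pd d j (bergman d σ G) z = ((∑ j, ‖pd d j (bergman d σ G) z‖^2 : ℝ) : ℂ) := by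
      push_cast
      refine Finset.sum_congr rfl fun j _ => ?_
      rw [← Complex.conj_mul']
    rw [this, Complex.norm_real, Real.norm_of_nonneg (by positivity)]
  rw [h2] at h
  rw [← hv]
  rcases (norm_nonneg v).eq_or_lt with h0 | h0
  · rw [← h0, mul_zero]
    have hl0 : 0 < l := by
      have hd' : (1:ℝ) ≤ d := by exact_mod_cast hd
      linarith
    have := Real.Gamma_pos_of_pos (show 0 < l + 1 by linarith)
    positivity
  · refine le_of_mul_le_mul_right ?_ h0
    linarith

lemma lower_bound {d : ℕ} (hd : 0 < d) {σ : ℝ} (hσ : -1 < σ) {l : ℝ} (hl : l = d + 1 + σ)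
    {z : Cd d} (hz : ‖z‖ < 1) {ε : ℝ} (hε : 0 < ε) :
    ∃ G : Cd d → ℂ, Measurable G ∧ (∀ w, ‖G w‖ ≤ 1) ∧
      l * ((1 - ε) * (Real.Gamma l / Real.Gamma ((l+1)/2)^2 * ∑' n, qs l n * (‖z‖^2)^n) - ε^(-l)) ≤
        ‖fderiv ℂ (bergman d σ G) z z‖ := by
  have hl0 : 0 < l := by
    have hd' : (1:ℝ) ≤ d := by exact_mod_cast hd
    linarith
  have hc := cCoef_pos d hσ
  let G : Cd d → ℂ := fun w => (1 - herm z w)^(((l+1:ℝ)):ℂ) / ((‖1 - herm z w‖^(l+1) : ℝ) : ℂ)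
  have hG : Measurable G := by
    have := herm_measurable z
    simp only [G]; fun_prop
  have hG1 : ∀ w, ‖G w‖ ≤ 1 := by
    intro w
    simp only [G]
    rw [norm_div, Complex.norm_cpow_real, Complex.norm_real, Real.norm_of_nonneg (by positivity)]
    exact div_self_le_one _
  refine ⟨G, hG, hG1, ?_⟩
  have hpt : ∀ w ∈ unitBall d, ((1 - ‖w‖^2)^σ : ℝ) •
        ((l:ℂ) * (1 - herm z w)^(-((l+1:ℝ):ℂ)) * G w * herm z w) =
      ((1 - ‖w‖^2)^σ * (l * ‖1 - herm z w‖^(-(l+1))) : ℝ) • herm z w := by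
    intro w hw
    have ht : 0 < ‖1 - herm z w‖ := (sub_pos.2 hz).trans_le (one_sub_herm_lower hw)
    have hne : 1 - herm z w ≠ 0 := norm_pos_iff.1 ht
    have hne2 : (1 - herm z w)^(((l+1:ℝ)):ℂ) ≠ 0 := by
      rw [Complex.cpow_ne_zero_iff]; left; exact hne
    rw [Complex.real_smul, Complex.real_smul]
    simp only [G]
    rw [Complex.cpow_neg, Real.rpow_neg ht.le]
    set A := (1 - herm z w)^(((l+1:ℝ)):ℂ)
    rw [Complex.ofReal_mul, Complex.ofReal_mul, Complex.ofReal_inv]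
    field_simp
  rw [bergman_fderiv_apply hd hσ hl hG hG1 hz, integral_congr_ae (ae_unitBall hpt)]
  have hint : Integrable (fun w => ((1 - ‖w‖^2)^σ * (l * ‖1 - herm z w‖^(-(l+1))) : ℝ) • herm z w)
      ((normVol d).restrict (unitBall d)) := by
    have h1 := ((kernel_integrable hd hσ hl0 hz).mul_const l).smul_bdd 1
      (herm_continuous z).aestronglyMeasurable (ae_unitBall fun w hw => (norm_herm_le' z hw).trans hz.le)
    refine h1.congr (ae_of_all _ fun w => ?_)
    rw [Pi.smul_apply']
    congr 1; ring
  set I := ∫ w in unitBall d, ((1 - ‖w‖^2)^σ * (l * ‖1 - herm z w‖^(-(l+1))) : ℝ) • herm z w ∂(normVol d) with hI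
  have hre : I.re = ∫ w in unitBall d, ((1 - ‖w‖^2)^σ * (l * ‖1 - herm z w‖^(-(l+1)))) * (herm z w).re ∂(normVol d) := by
    have := Complex.reCLM.integral_comp_comm hint
    rw [hI, ← Complex.reCLM_apply, ← this]
    refine integral_congr_ae (ae_of_all _ fun w => ?_)
    simp
  have hreint := Complex.reCLM.integrable_comp hint
  have hlow : ∫ w in unitBall d, (l * (1 - ε)) * ((1 - ‖w‖^2)^σ * ‖1 - herm z w‖^(-(l+1))) -
      (l * ε^(-l)) * (1 - ‖w‖^2)^σ ∂(normVol d) ≤ I.re := by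
    rw [hre]
    refine integral_mono_ae (((kernel_integrable hd hσ hl0 hz).const_mul _).sub
      ((weight_integrable hd hσ).const_mul _)) (hreint.congr (ae_of_all _ fun w => by simp)) 
      (ae_unitBall fun w hw => ?_)
    have ht : 0 < ‖1 - herm z w‖ := (sub_pos.2 hz).trans_le (one_sub_herm_lower hw)
    have hu : 1 - ‖1 - herm z w‖ ≤ (herm z w).re := by
      have := Complex.re_le_norm (1 - herm z w)
      simp at this
      linarith
    have h3 := weight_nonneg σ hw
    have h4 := pt_ineq hl0 hε ht
    set t := ‖1 - herm z w‖
    have h5 : t^(-l) = t * t^(-(l+1)) := by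
      conv_rhs => rw [← Real.rpow_one t, ← Real.rpow_mul ht.le, ← Real.rpow_add ht]
      congr 1; ring
    have h6 : 0 ≤ t^(-(l+1)) := by positivity
    have h7 : (1 - ε) * t^(-(l+1)) - ε^(-l) ≤ t^(-(l+1)) * (herm z w).re := by nlinarith
    have h8 := mul_le_mul_of_nonneg_left h7 (mul_nonneg h3 hl0.le)
    simp only
    linarith
  rw [integral_sub ((kernel_integrable hd hσ hl0 hz).const_mul _)
      ((weight_integrable hd hσ).const_mul _), integral_const_mul, integral_const_mul] at hlow
  have hJ := J_eq hd hσ hl hz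
  have hW := weight_integral hd hσ
  have h9 := mul_le_mul_of_nonneg_left (hlow.trans (Complex.re_le_norm I)) hc.le
  rw [norm_mul, Complex.norm_real, Real.norm_of_nonneg hc.le]
  refine le_trans (le_of_eq ?_) h9
  rw [← hJ]
  linear_combination (l * ε^(-l)) * hW

lemma lower_unit {d : ℕ} (hd : 0 < d) {σ : ℝ} (hσ : -1 < σ) {l : ℝ} (hl : l = d + 1 + σ)
    {ζ : Cd d} (hζ : ‖ζ‖ = 1) {c : ℝ} (hc : c < Real.Gamma (l+1) / Real.Gamma ((l+1)/2)^2) :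
    ∃ G : Cd d → ℂ, Measurable G ∧ (∀ w, ‖G w‖ ≤ 1) ∧ ∃ z ∈ unitBall d,
      c < (1 - ‖z‖^2) * ‖fderiv ℂ (bergman d σ G) z ζ‖ := by
  have hl0 : 0 < l := by
    have hd' : (1:ℝ) ≤ d := by exact_mod_cast hd
    linarith
  rw [Real.Gamma_add_one hl0.ne', mul_div_assoc] at hc
  set K := Real.Gamma l / Real.Gamma ((l+1)/2)^2 with hK
  obtain ⟨ε, hε, hcε⟩ : ∃ ε : ℝ, 0 < ε ∧ c < l * ((1 - ε) * K) := by
    have h1 : Filter.Tendsto (fun ε : ℝ => l * ((1 - ε) * K)) (𝓝[>] 0) (𝓝 (l * K)) := by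
      have : Continuous (fun ε : ℝ => l * ((1 - ε) * K)) := by fun_prop
      have := (this.tendsto 0).mono_left (nhdsWithin_le_nhds (s := Ioi 0))
      simpa using this
    obtain ⟨ε, h2, h3⟩ := ((h1.eventually (lt_mem_nhds hc)).and self_mem_nhdsWithin).exists
    exact ⟨ε, h3, h2⟩
  have hlim : Filter.Tendsto (fun x : ℝ => l * ((1 - ε) * (K * ((1 - x) * ∑' n, qs l n * x^n)) - (1 - x) * ε^(-l)))
      (𝓝[<] 1) (𝓝 (l * ((1 - ε) * (K * 1) - 0))) := by
    refine Filter.Tendsto.const_mul _ (Filter.Tendsto.sub (((qs_limit hl0).const_mul _).const_mul _) ?_)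
    have : Continuous (fun x : ℝ => (1 - x) * ε^(-l)) := by fun_prop
    have := (this.tendsto 1).mono_left (nhdsWithin_le_nhds (s := Iio 1))
    simpa using this
  have hpos : ∀ᶠ x in 𝓝[<] (1:ℝ), 0 < x := nhdsWithin_le_nhds (lt_mem_nhds one_pos)
  obtain ⟨x, ⟨hx1, hx0⟩, hx2⟩ := (((hlim.eventually (lt_mem_nhds (by simpa using hcε))).and hpos).and
    self_mem_nhdsWithin).exists
  have hx2 : x < 1 := hx2
  set r := Real.sqrt x with hr
  have hr0 : 0 < r := Real.sqrt_pos.2 hx0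
  have hr2 : r^2 = x := Real.sq_sqrt hx0.le
  have hr1 : r < 1 := by nlinarith
  let z : Cd d := (r:ℂ) • ζ
  have hz : ‖z‖ = r := by
    simp only [z, norm_smul, hζ, Complex.norm_real, Real.norm_of_nonneg hr0.le, mul_one]
  obtain ⟨G, hG, hG1, hb⟩ := lower_bound hd hσ hl (z := z) (by rw [hz]; exact hr1) hε
  refine ⟨G, hG, hG1, z, by simpa [unitBall, hz] using hr1, ?_⟩
  rw [hz, hr2] at hb ⊢
  have h1 : ‖fderiv ℂ (bergman d σ G) z z‖ ≤ ‖fderiv ℂ (bergman d σ G) z ζ‖ := by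
    have : fderiv ℂ (bergman d σ G) z z = (r:ℂ) * fderiv ℂ (bergman d σ G) z ζ := by
      rw [← smul_eq_mul, ← map_smul]
    rw [this, norm_mul, Complex.norm_real, Real.norm_of_nonneg hr0.le]
    exact mul_le_of_le_one_left (norm_nonneg _) hr1.le
  have h2 := mul_le_mul_of_nonneg_left (hb.trans h1) (sub_nonneg.2 hx2.le)
  refine lt_of_lt_of_le hx1 (le_trans (le_of_eq ?_) h2)
  ring

end PartI

section PartJ
open Set Module Topology

/-- Abstract reduction of the double supremum. -/
lemma sup_eq {d : ℕ} {L : ℝ} (hL : 0 ≤ L)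
    (Φ : {G : Cd d → ℂ // Measurable G ∧ ∀ w, ‖G w‖ ≤ 1} → unitBall d → ℝ)
    (hup : ∀ G z, Φ G z ≤ L) (hlow : ∀ c < L, ∃ G z, c < Φ G z) :
    (⨆ G, ⨆ z, Φ G z) = L := by
  have hb : ∀ G, BddAbove (range (Φ G)) := fun G => ⟨L, by rintro _ ⟨z, rfl⟩; exact hup G z⟩
  have hin : ∀ G, (⨆ z, Φ G z) ≤ L := fun G => Real.iSup_le (hup G) hL
  have hb2 : BddAbove (range fun G => ⨆ z, Φ G z) := ⟨L, by rintro _ ⟨G, rfl⟩; exact hin G⟩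
  refine le_antisymm (Real.iSup_le hin hL) (le_of_forall_lt fun c hc => ?_)
  obtain ⟨G, z, h⟩ := hlow c hc
  exact h.trans_le ((le_ciSup (hb G) z).trans (le_ciSup hb2 G))

end PartJ

/-- The case `n = 1` with the Bloch seminorm
`‖f‖_𝓑 = sup_{z∈B} (1-|z|²)(∑_j |∂f/∂z_j(z)|^p)^{1/p}`:
`‖T_σ‖_{L^∞(B)→𝓑} = C_p Γ(λ+1)/Γ((λ+1)/2)²` with `C_p = d^{1/p-1/2}` for `1 ≤ p < 2`
and `C_p = 1` for `2 ≤ p`. -/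
theorem bergman_projection_seminorm_lp_gradient
    (d : ℕ) (hd : 0 < d) (σ : ℝ) (hσ : -1 < σ) (lam : ℝ) (hlam : lam = d + 1 + σ)
    (p : ℝ) (hp : 1 ≤ p) :
    (p < 2 →
      (⨆ G : {G : Cd d → ℂ // Measurable G ∧ ∀ w, ‖G w‖ ≤ 1},
          ⨆ z : unitBall d,
            (1 - ‖(z : Cd d)‖ ^ 2) *
              (∑ j, ‖pd d j (bergman d σ G.1) (z : Cd d)‖ ^ p) ^ (1 / p)) =
        (d : ℝ) ^ (1 / p - 1 / 2) * (Real.Gamma (lam + 1) / Real.Gamma ((lam + 1) / 2) ^ 2)) ∧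
    (2 ≤ p →
      (⨆ G : {G : Cd d → ℂ // Measurable G ∧ ∀ w, ‖G w‖ ≤ 1},
          ⨆ z : unitBall d,
            (1 - ‖(z : Cd d)‖ ^ 2) *
              (∑ j, ‖pd d j (bergman d σ G.1) (z : Cd d)‖ ^ p) ^ (1 / p)) =
        Real.Gamma (lam + 1) / Real.Gamma ((lam + 1) / 2) ^ 2) := by
  have hG0 : 0 < lam := by
    have hd' : (1:ℝ) ≤ d := by exact_mod_cast hd
    linarith
  set L := Real.Gamma (lam + 1) / Real.Gamma ((lam + 1) / 2) ^ 2 with hLdef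
  have hL : 0 ≤ L := by
    have := Real.Gamma_pos_of_pos (show 0 < lam + 1 by linarith)
    positivity
  have hd0 : (0:ℝ) < d := by exact_mod_cast hd
  have hnz : ∀ z : unitBall d, ‖(z : Cd d)‖ < 1 := fun z => by
    have := z.2
    simpa [unitBall] using this
  have hnz2 : ∀ z : unitBall d, 0 ≤ 1 - ‖(z : Cd d)‖^2 := fun z => by
    nlinarith [norm_nonneg (z : Cd d), hnz z]
  constructor
  · intro hp2
    refine sup_eq (by positivity) _ (fun G z => ?_) (fun c hc => ?_)
    · have h1 := grad_bound hd hσ hlam G.2.1 G.2.2 (hnz z)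
      have h2 := lp_le_const_l2 (fun j => ‖pd d j (bergman d σ G.1) (z : Cd d)‖)
        (fun j => norm_nonneg _) hp hp2
      calc _ ≤ (1 - ‖(z : Cd d)‖ ^ 2) * ((d:ℝ)^(1/p - 1/2) *
            Real.sqrt (∑ j, ‖pd d j (bergman d σ G.1) (z : Cd d)‖ ^ 2)) :=
            mul_le_mul_of_nonneg_left h2 (hnz2 z)
        _ = (d:ℝ)^(1/p - 1/2) * ((1 - ‖(z : Cd d)‖ ^ 2) *
            Real.sqrt (∑ j, ‖pd d j (bergman d σ G.1) (z : Cd d)‖ ^ 2)) := by ring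
        _ ≤ _ := by gcongr
    · have hD : 0 < (d:ℝ)^(1/p - 1/2) := by positivity
      have hc' : c / (d:ℝ)^(1/p - 1/2) < L := by rw [div_lt_iff₀ hD]; linarith
      let ζ : Cd d := WithLp.toLp 2 (fun _ => (((d:ℝ)^(-(1/2:ℝ)) : ℝ) : ℂ))
      have hζ : ‖ζ‖ = 1 := by
        rw [EuclideanSpace.norm_eq]
        simp only [ζ, Complex.norm_real]
        rw [Real.norm_of_nonneg (by positivity), Finset.sum_const, Finset.card_univ, Fintype.card_fin,
          ← Real.rpow_natCast, ← Real.rpow_mul hd0.le]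
        norm_num
        rw [Real.rpow_neg_one, ← Real.sqrt_mul hd0.le, mul_inv_cancel₀ hd0.ne', Real.sqrt_one]
      obtain ⟨G, hG, hG1, z, hz, h⟩ := lower_unit hd hσ hlam hζ hc'
      refine ⟨⟨G, hG, hG1⟩, ⟨z, hz⟩, ?_⟩
      rw [div_lt_iff₀ hD] at h
      refine h.trans_le ?_
      simp only
      rw [mul_assoc]
      refine mul_le_mul_of_nonneg_left ?_ (hnz2 ⟨z, hz⟩)
      have h3 := l1_le_lp (fun j => ‖pd d j (bergman d σ G) z‖) (fun j => norm_nonneg _) hp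
      have h4 : ‖fderiv ℂ (bergman d σ G) z ζ‖ ≤
          (d:ℝ)^(-(1/2:ℝ)) * ∑ j, ‖pd d j (bergman d σ G) z‖ := by
        rw [pd_sum, Finset.mul_sum]
        refine (norm_sum_le _ _).trans (le_of_eq (Finset.sum_congr rfl fun j _ => ?_))
        rw [norm_mul]
        simp only [ζ, Complex.norm_real]
        rw [Real.norm_of_nonneg (by positivity)]
      calc _ ≤ ((d:ℝ)^(-(1/2:ℝ)) * ((d:ℝ)^(1 - 1/p) *
            (∑ j, ‖pd d j (bergman d σ G) z‖ ^ p) ^ (1/p))) * (d:ℝ)^(1/p - 1/2) := by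
            gcongr
            exact h4.trans (by gcongr)
        _ = ((d:ℝ)^(-(1/2:ℝ)) * (d:ℝ)^(1 - 1/p) * (d:ℝ)^(1/p - 1/2)) *
            (∑ j, ‖pd d j (bergman d σ G) z‖ ^ p) ^ (1/p) := by ring
        _ = _ := by
          rw [← Real.rpow_add hd0, ← Real.rpow_add hd0]
          ring_nf
          simp
  · intro hp2
    refine sup_eq hL _ (fun G z => ?_) (fun c hc => ?_)
    · have h1 := grad_bound hd hσ hlam G.2.1 G.2.2 (hnz z)
      have h2 := lp_le_l2 (fun j => ‖pd d j (bergman d σ G.1) (z : Cd d)‖)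
        (fun j => norm_nonneg _) hp2
      exact (mul_le_mul_of_nonneg_left h2 (hnz2 z)).trans h1
    · obtain ⟨G, hG, hG1, z, hz, h⟩ := lower_unit hd hσ hlam
        (ζ := EuclideanSpace.single (⟨0, hd⟩ : Fin d) 1) (by simp) hc
      refine ⟨⟨G, hG, hG1⟩, ⟨z, hz⟩, h.trans_le ?_⟩
      have h3 := single_le_lp (fun j => ‖pd d j (bergman d σ G) z‖) (fun j => norm_nonneg _) hp ⟨0, hd⟩
      exact mul_le_mul_of_nonneg_left h3 (hnz2 ⟨z, hz⟩)
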